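/- Let K be a field of characteristic zero, r ≥ 2, and let L be the free nilpotent Lie algebra of rank r and step 3 over K, with G_1 the span of the generators. Fix p ∈ L* and set h_1(p) = {ξ ∈ G_1 : p(⁅ξ,η⁆) = 0 for all η ∈ C_1(L)}, k(p) = {γ ∈ h_1(p) : p(⁅δ,γ⁆) = 0 for all δ ∈ h_1(p)}, and let R(p) = {v ∈ L : p(⁅w,v⁆) = 0 for all w ∈ L} be the radical of B_p. Writing k_1 = dim h_1(p) and k_2 = dim k(p), one has dim R(p) = dim L − 2r + k_1 + k_2; equivalently, the rank of the skew-symmetric form B_p (the dimension of the coadjoint orbit through p) equals 2r − (k_1 + k_2). -/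

import Mathlib

/-- The free nilpotent Lie algebra of rank `r` and step `s` over `K`: the quotient of the
free Lie algebra `F` on `r` generators by the `s`-th term `C_s(F)` of its lower central
series (`C_0 = F`, `C_{k+1} = ⁅F, C_k⁆`). -/
abbrev FreeNilpotentLie (K : Type*) [Field K] (r s : ℕ) :=
  FreeLieAlgebra K (Fin r) ⧸
    LieModule.lowerCentralSeries K (FreeLieAlgebra K (Fin r)) (FreeLieAlgebra K (Fin r)) s

/-- The canonical generators `X_1, …, X_r` of the free nilpotent Lie algebra, i.e. the images
of the free generators. -/
noncomputable def FreeNilpotentLie.gen (K : Type*) [Field K] (r s : ℕ) (i : Fin r) :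
    FreeNilpotentLie K r s :=
  LieSubmodule.Quotient.mk' _ (FreeLieAlgebra.of K i)

/-- `G₁`: the `K`-span of the generators. -/
noncomputable def FreeNilpotentLie.G1 (K : Type*) [Field K] (r s : ℕ) :
    Submodule K (FreeNilpotentLie K r s) :=
  Submodule.span K (Set.range (FreeNilpotentLie.gen K r s))


/-- The radical of the skew form `B_p(x, y) = p ⁅x, y⁆`. -/
noncomputable def radicalBp {K L : Type*} [Field K] [LieRing L] [LieAlgebra K L]
    (p : Module.Dual K L) : Submodule K L where
  carrier := {v | ∀ w : L, p ⁅w, v⁆ = 0}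
  add_mem' := fun {a b} ha hb w => by simp [lie_add, ha w, hb w]
  zero_mem' := fun w => by simp
  smul_mem' := fun c x hx w => by simp [lie_smul, hx w]

/-- `{ξ | ∀ η ∈ S, p ⁅ξ, η⁆ = 0}` as a subspace. -/
noncomputable def perpRight {K L : Type*} [Field K] [LieRing L] [LieAlgebra K L]
    (p : Module.Dual K L) (S : Set L) : Submodule K L where
  carrier := {ξ : L | ∀ η ∈ S, p ⁅ξ, η⁆ = 0}
  add_mem' := fun {a b} ha hb η hη => by simp [add_lie, ha η hη, hb η hη]
  zero_mem' := fun η hη => by simp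
  smul_mem' := fun c x hx η hη => by simp [smul_lie, hx η hη]

/-- `{η | ∀ ξ ∈ S, p ⁅ξ, η⁆ = 0}` as a subspace. -/
noncomputable def perpLeft {K L : Type*} [Field K] [LieRing L] [LieAlgebra K L]
    (p : Module.Dual K L) (S : Set L) : Submodule K L where
  carrier := {η : L | ∀ ξ ∈ S, p ⁅ξ, η⁆ = 0}
  add_mem' := fun {a b} ha hb ξ hξ => by simp [lie_add, ha ξ hξ, hb ξ hξ]
  zero_mem' := fun ξ hξ => by simp
  smul_mem' := fun c x hx ξ hξ => by simp [lie_smul, hx ξ hξ]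

open Module

section LowerCentralSeries

variable {K L : Type*} [Field K] [LieRing L] [LieAlgebra K L]

theorem lie_mem_lowerCentralSeries_succ {k : ℕ} (x : L) {y : L}
    (hy : y ∈ LieModule.lowerCentralSeries K L L k) :
    ⁅x, y⁆ ∈ LieModule.lowerCentralSeries K L L (k + 1) := by
  rw [LieModule.lowerCentralSeries_succ]
  exact LieSubmodule.lie_mem_lie (LieSubmodule.mem_top x) hy

theorem lie_mem_lowerCentralSeries_one (x y : L) :
    ⁅x, y⁆ ∈ LieModule.lowerCentralSeries K L L 1 :=
  lie_mem_lowerCentralSeries_succ (k := 0) x (by simp)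

theorem lowerCentralSeries_succ_le {k : ℕ} {S : Submodule K L}
    (h : ∀ x : L, ∀ y ∈ LieModule.lowerCentralSeries K L L k, ⁅x, y⁆ ∈ S) :
    (LieModule.lowerCentralSeries K L L (k + 1)).toSubmodule ≤ S := by
  rw [LieModule.lowerCentralSeries_succ, LieSubmodule.lieIdeal_oper_eq_linear_span',
    Submodule.span_le]
  rintro _ ⟨x, -, y, hy, rfl⟩
  exact h x y hy

theorem lie_mem_lowerCentralSeries_three {x y : L}
    (hx : x ∈ LieModule.lowerCentralSeries K L L 1)
    (hy : y ∈ LieModule.lowerCentralSeries K L L 1) :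
    ⁅x, y⁆ ∈ LieModule.lowerCentralSeries K L L 3 := by
  let S : Submodule K L :=
    { carrier := {x | ⁅x, y⁆ ∈ LieModule.lowerCentralSeries K L L 3}
      add_mem' := fun {a b} ha hb => by
        change ⁅a + b, y⁆ ∈ LieModule.lowerCentralSeries K L L 3
        rw [add_lie]
        exact add_mem ha hb
      zero_mem' := by simp
      smul_mem' := fun c a ha => by
        change ⁅c • a, y⁆ ∈ LieModule.lowerCentralSeries K L L 3
        rw [smul_lie]
        exact (LieModule.lowerCentralSeries K L L 3).smul_mem c ha }
  refine lowerCentralSeries_succ_le (k := 0) (S := S) (fun a b _ => ?_) hx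
  change ⁅⁅a, b⁆, y⁆ ∈ LieModule.lowerCentralSeries K L L 3
  rw [lie_lie]
  exact sub_mem (lie_mem_lowerCentralSeries_succ a (lie_mem_lowerCentralSeries_succ b hy))
    (lie_mem_lowerCentralSeries_succ b (lie_mem_lowerCentralSeries_succ a hy))

/-- A Lie algebra of nilpotency class at most three which is generated, modulo its derived
algebra, by a finite-dimensional subspace is finite-dimensional. -/
theorem finiteDimensional_of_lowerCentralSeries_three_eq_bot
    (h : LieModule.lowerCentralSeries K L L 3 = ⊥) (G : Submodule K L) [FiniteDimensional K G]
    (hG : G ⊔ (LieModule.lowerCentralSeries K L L 1).toSubmodule = ⊤) :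
    FiniteDimensional K L := by
  set C : Submodule K L := (LieModule.lowerCentralSeries K L L 1).toSubmodule
  let b : L →ₗ[K] L →ₗ[K] L := (LieModule.toEnd K L L : L →ₗ[K] Module.End K L)
  have hb (x y : L) : b x y = ⁅x, y⁆ := rfl
  let T₂ := Submodule.map₂ b G G
  let T₃ := Submodule.map₂ b G T₂
  have hGfg : G.FG := Module.Finite.iff_fg.mp ‹_›
  have hT₂ : T₂.FG := hGfg.map₂ b hGfg
  have hT₃ : T₃.FG := hGfg.map₂ b hT₂
  have decomp (x : L) : ∃ g ∈ G, ∃ c ∈ C, g + c = x :=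
    Submodule.mem_sup.mp (hG ▸ Submodule.mem_top)
  have hCC {x y : L} (hx : x ∈ C) (hy : y ∈ C) : ⁅x, y⁆ = 0 := by
    have := lie_mem_lowerCentralSeries_three (K := K) hx hy
    rwa [h, LieSubmodule.mem_bot] at this
  have lie_mem (x y : L) : ⁅x, y⁆ ∈ T₂ ⊔ Submodule.map₂ b G C := by
    obtain ⟨g, hg, c, hc, rfl⟩ := decomp x
    obtain ⟨g', hg', c', hc', rfl⟩ := decomp y
    have h₁ : ⁅g, g'⁆ ∈ T₂ := Submodule.apply_mem_map₂ b hg hg'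
    have h₂ : ⁅g, c'⁆ ∈ Submodule.map₂ b G C := Submodule.apply_mem_map₂ b hg hc'
    have h₃ : ⁅g', c⁆ ∈ Submodule.map₂ b G C := Submodule.apply_mem_map₂ b hg' hc
    have : ⁅g + c, g' + c'⁆ = ⁅g, g'⁆ + (⁅g, c'⁆ - ⁅g', c⁆) := by
      rw [add_lie, lie_add, lie_add, hCC hc hc', ← lie_skew c g']
      abel
    rw [this]
    exact Submodule.add_mem_sup h₁ (sub_mem h₂ h₃)
  have hCle : C ≤ T₂ ⊔ Submodule.map₂ b G C :=
    lowerCentralSeries_succ_le (k := 0) fun x y _ => lie_mem x y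
  have hGGC : Submodule.map₂ b G (Submodule.map₂ b G C) ≤ ⊥ := by
    refine Submodule.map₂_le.mpr fun x _ y hy => ?_
    have hy' : y ∈ (LieModule.lowerCentralSeries K L L 2).toSubmodule :=
      (Submodule.map₂_le.mpr fun u _ v hv => lie_mem_lowerCentralSeries_succ u hv :
        Submodule.map₂ b G C ≤ _) hy
    have := lie_mem_lowerCentralSeries_succ (K := K) x hy'
    rwa [h, LieSubmodule.mem_bot] at this
  have hGC : Submodule.map₂ b G C ≤ T₃ := by
    refine (Submodule.map₂_le_map₂_right hCle).trans ?_
    rw [Submodule.map₂_sup_right]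
    exact sup_le le_rfl (hGGC.trans bot_le)
  have htop : G ⊔ (T₂ ⊔ T₃) = ⊤ :=
    top_le_iff.mp (hG ▸ sup_le_sup_left (hCle.trans (sup_le_sup_left hGC _)) _)
  exact ⟨htop ▸ hGfg.sup (hT₂.sup hT₃)⟩

end LowerCentralSeries

section Radical

variable {K L : Type*} [Field K] [LieRing L] [LieAlgebra K L] [FiniteDimensional K L]

/-- The dimension of the radical of `B_p` when `L = V ⊕ W` with `W` isotropic for `B_p`. -/
theorem finrank_radicalBp_add_of_isCompl (p : Module.Dual K L) {V W : Submodule K L}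
    (hVW : IsCompl V W) (hW : ∀ x ∈ W, ∀ y ∈ W, p ⁅x, y⁆ = 0) :
    finrank K (radicalBp p) + finrank K V =
      finrank K W + finrank K ↥(V ⊓ perpRight p (W : Set L)) +
        finrank K ↥((V ⊓ perpRight p (W : Set L)) ⊓
          perpLeft p ((V ⊓ perpRight p (W : Set L) : Submodule K L) : Set L)) := by
  set H := V ⊓ perpRight p (W : Set L)
  set k := H ⊓ perpLeft p (H : Set L)
  let B : LinearMap.BilinForm K L :=
    (LieModule.toEnd K L L : L →ₗ[K] Module.End K L).compr₂ p
  have hB (x y : L) : B x y = p ⁅x, y⁆ := rfl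
  have skew (x y : L) : p ⁅x, y⁆ = -p ⁅y, x⁆ := by rw [← lie_skew, map_neg]
  have swap {x y : L} (h : p ⁅x, y⁆ = 0) : p ⁅y, x⁆ = 0 := by rw [skew, h, neg_zero]
  have hker : B.ker = radicalBp p := by
    ext v
    refine ⟨fun h w => swap ?_, fun h => LinearMap.ext fun w => swap (h w)⟩
    exact LinearMap.congr_fun (LinearMap.mem_ker.mp h) w
  have hHW : B.orthogonal (W ⊔ H) = W ⊔ k := by
    apply le_antisymm
    · intro x hx
      obtain ⟨v, hv, w, hw, rfl⟩ := Submodule.mem_sup.mp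
        (hVW.sup_eq_top ▸ Submodule.mem_top : x ∈ V ⊔ W)
      have hvH : v ∈ H := by
        refine ⟨hv, fun y hy => swap ?_⟩
        have := hx y (Submodule.mem_sup_left hy)
        rwa [hB, lie_add, map_add, hW y hy w hw, add_zero] at this
      have hvk : v ∈ k := by
        refine ⟨hvH, fun y hy => ?_⟩
        have := hx y (Submodule.mem_sup_right hy)
        rwa [hB, lie_add, map_add, hy.2 w hw, add_zero] at this
      exact add_comm w v ▸ Submodule.add_mem_sup hw hvk
    · refine sup_le (fun w hw x hx => ?_) (fun u hu x hx => ?_) <;>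
      obtain ⟨y, hy, z, hz, rfl⟩ := Submodule.mem_sup.mp hx <;>
      rw [hB, add_lie, map_add]
      · rw [hW y hy w hw, hz.2 w hw, add_zero]
      · rw [swap (hu.1.2 y hy), hu.2 z hz, add_zero]
  have hle : radicalBp p ≤ W ⊔ H := by
    intro x hx
    obtain ⟨v, hv, w, hw, rfl⟩ := Submodule.mem_sup.mp
      (hVW.sup_eq_top ▸ Submodule.mem_top : x ∈ V ⊔ W)
    refine add_comm w v ▸ Submodule.add_mem_sup hw ⟨hv, fun y hy => swap ?_⟩
    have := hx y
    rwa [lie_add, map_add, hW y hy w hw, add_zero] at this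
  have finrank_sup {U : Submodule K L} (hU : U ≤ V) :
      finrank K ↥(W ⊔ U) = finrank K W + finrank K U := by
    rw [← Submodule.finrank_sup_add_finrank_inf_eq, (hVW.disjoint.mono_left hU).symm.eq_bot,
      finrank_bot, add_zero]
  have h₁ := LinearMap.BilinForm.finrank_add_finrank_orthogonal' (B := B) (W ⊔ H)
  rw [hHW, hker, inf_eq_right.mpr hle, finrank_sup (U := H) inf_le_left,
    finrank_sup (U := k) (inf_le_left.trans inf_le_left)] at h₁
  have h₂ := Submodule.finrank_add_eq_of_isCompl hVW
  omega

end Radical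

/-- The vector space `K^(n+2) × K^(n+2) × K`, carrying the nilpotent Lie bracket
`⁅(u, v, w), (u', v', w')⁆ = (0, u₀ u' - u'₀ u, u₀ v'₁ - u'₀ v₁)`. -/
def ModelLie (K : Type*) [Field K] (n : ℕ) : Type _ :=
  (Fin (n + 2) → K) × (Fin (n + 2) → K) × K

namespace ModelLie

variable {K : Type*} [Field K] {n : ℕ}

instance : AddCommGroup (ModelLie K n) :=
  inferInstanceAs (AddCommGroup ((Fin (n + 2) → K) × (Fin (n + 2) → K) × K))

instance : Module K (ModelLie K n) :=
  inferInstanceAs (Module K ((Fin (n + 2) → K) × (Fin (n + 2) → K) × K))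

/-- The first component of an element of `ModelLie K n`. -/
def fstₗ : ModelLie K n →ₗ[K] (Fin (n + 2) → K) := LinearMap.fst _ _ _

/-- The second component of an element of `ModelLie K n`. -/
def sndₗ : ModelLie K n →ₗ[K] (Fin (n + 2) → K) := LinearMap.fst _ _ _ ∘ₗ LinearMap.snd _ _ _

/-- The third component of an element of `ModelLie K n`. -/
def thdₗ : ModelLie K n →ₗ[K] K := LinearMap.snd _ _ _ ∘ₗ LinearMap.snd _ _ _

theorem ext' {x y : ModelLie K n} (h₁ : fstₗ x = fstₗ y) (h₂ : sndₗ x = sndₗ y)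
    (h₃ : thdₗ x = thdₗ y) : x = y :=
  Prod.ext h₁ (Prod.ext h₂ h₃)

instance : Bracket (ModelLie K n) (ModelLie K n) :=
  ⟨fun x y => (0, fstₗ x 0 • fstₗ y - fstₗ y 0 • fstₗ x,
    fstₗ x 0 * sndₗ y 1 - fstₗ y 0 * sndₗ x 1)⟩

@[simp]
theorem fstₗ_lie (x y : ModelLie K n) : fstₗ ⁅x, y⁆ = 0 := rfl

@[simp]
theorem sndₗ_lie (x y : ModelLie K n) :
    sndₗ ⁅x, y⁆ = fstₗ x 0 • fstₗ y - fstₗ y 0 • fstₗ x := rfl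

@[simp]
theorem thdₗ_lie (x y : ModelLie K n) :
    thdₗ ⁅x, y⁆ = fstₗ x 0 * sndₗ y 1 - fstₗ y 0 * sndₗ x 1 := rfl

instance : LieRing (ModelLie K n) where
  add_lie x y z := by
    apply ext' <;> simp only [fstₗ_lie, sndₗ_lie, thdₗ_lie, map_add, Pi.add_apply, add_zero]
    · module
    · ring
  lie_add x y z := by
    apply ext' <;> simp only [fstₗ_lie, sndₗ_lie, thdₗ_lie, map_add, Pi.add_apply, add_zero]
    · module
    · ring
  lie_self x := by apply ext' <;> simp
  leibniz_lie x y z := by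
    apply ext' <;> simp
    ring

instance : LieAlgebra K (ModelLie K n) where
  lie_smul c x y := by
    apply ext' <;> simp only [fstₗ_lie, sndₗ_lie, thdₗ_lie, map_smul, Pi.smul_apply, smul_zero,
      smul_eq_mul]
    · module
    · ring

theorem fstₗ_eq_zero_of_mem {x : ModelLie K n}
    (hx : x ∈ LieModule.lowerCentralSeries K (ModelLie K n) (ModelLie K n) 1) : fstₗ x = 0 :=
  lowerCentralSeries_succ_le (k := 0) (S := LinearMap.ker (fstₗ (K := K))) (fun a b _ => by simp) hx

theorem sndₗ_eq_zero_of_mem {x : ModelLie K n}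
    (hx : x ∈ LieModule.lowerCentralSeries K (ModelLie K n) (ModelLie K n) 2) : sndₗ x = 0 :=
  lowerCentralSeries_succ_le (k := 1) (S := LinearMap.ker (sndₗ (K := K)))
    (fun a b hb => by simp [fstₗ_eq_zero_of_mem hb]) hx

theorem lowerCentralSeries_three :
    LieModule.lowerCentralSeries K (ModelLie K n) (ModelLie K n) 3 = ⊥ := by
  have h := lowerCentralSeries_succ_le (K := K) (L := ModelLie K n) (k := 2) (S := ⊥)
    fun a b hb => by
      have h₁ : fstₗ b = 0 := fstₗ_eq_zero_of_mem
        (LieModule.antitone_lowerCentralSeries K _ _ one_le_two hb)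
      exact ext' (by simp) (by simp [h₁]) (by simp [h₁, sndₗ_eq_zero_of_mem hb])
  exact le_bot_iff.mp h

/-- The images of the free generators in `ModelLie K n`. -/
def gen (i : Fin (n + 2)) : ModelLie K n := (Pi.single i 1, 0, 0)

@[simp]
theorem fstₗ_gen (i : Fin (n + 2)) : fstₗ (gen i : ModelLie K n) = Pi.single i 1 := rfl

@[simp]
theorem sndₗ_gen (i : Fin (n + 2)) : sndₗ (gen i : ModelLie K n) = 0 := rfl

end ModelLie

namespace FreeNilpotentLie

variable {K : Type*} [Field K] {r s : ℕ}

variable (K r s) in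
/-- The projection from the free Lie algebra to the free nilpotent one. -/
noncomputable def proj : FreeLieAlgebra K (Fin r) →ₗ⁅K⁆ FreeNilpotentLie K r s :=
  { (LieSubmodule.Quotient.mk' (LieModule.lowerCentralSeries K (FreeLieAlgebra K (Fin r))
      (FreeLieAlgebra K (Fin r)) s) : _ →ₗ[K] _) with
    map_lie' := rfl }

theorem proj_of (i : Fin r) : proj K r s (FreeLieAlgebra.of K i) = gen K r s i := rfl

theorem proj_surjective : Function.Surjective (proj K r s) :=
  LieSubmodule.Quotient.surjective_mk' _

theorem lowerCentralSeries_eq_bot :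
    LieModule.lowerCentralSeries K (FreeNilpotentLie K r s) (FreeNilpotentLie K r s) s = ⊥ := by
  rw [← LieIdeal.lowerCentralSeries_map_eq s (proj_surjective (K := K) (r := r) (s := s)),
    LieIdeal.map_eq_bot_iff]
  intro x hx
  exact (LieSubmodule.Quotient.mk_eq_zero' (m := x)).mpr hx

theorem G1_sup_lowerCentralSeries_one :
    G1 K r s ⊔ (LieModule.lowerCentralSeries K (FreeNilpotentLie K r s)
      (FreeNilpotentLie K r s) 1).toSubmodule = ⊤ := by
  let S : LieSubalgebra K (FreeNilpotentLie K r s) :=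
    { G1 K r s ⊔ (LieModule.lowerCentralSeries K (FreeNilpotentLie K r s)
        (FreeNilpotentLie K r s) 1).toSubmodule with
      lie_mem' := fun {x y} _ _ =>
        Submodule.mem_sup_right (lie_mem_lowerCentralSeries_one x y) }
  have hgen (i : Fin r) : gen K r s i ∈ S :=
    Submodule.mem_sup_left (Submodule.subset_span ⟨i, rfl⟩)
  have h : S.incl.comp (FreeLieAlgebra.lift K fun i => (⟨gen K r s i, hgen i⟩ : S)) =
      proj K r s :=
    FreeLieAlgebra.hom_ext fun i => by simp [proj_of]
  refine eq_top_iff.mpr fun x _ => ?_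
  obtain ⟨y, rfl⟩ := proj_surjective x
  rw [← h]
  exact Subtype.property (p := (· ∈ S)) _

section Model

variable {n : ℕ}

variable (K n) in
/-- The Lie algebra morphism to `ModelLie K n` mapping generators to generators. -/
noncomputable def toModel : FreeNilpotentLie K (n + 2) 3 →ₗ⁅K⁆ ModelLie K n :=
  { Submodule.liftQ _
      (FreeLieAlgebra.lift K (ModelLie.gen : _ → ModelLie K n) : _ →ₗ[K] _)
      (fun x hx => by
        have h := LieIdeal.map_lowerCentralSeries_le 3
          (f := FreeLieAlgebra.lift K (ModelLie.gen : _ → ModelLie K n))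
        have := h (LieIdeal.mem_map hx)
        rwa [ModelLie.lowerCentralSeries_three, LieSubmodule.mem_bot] at this) with
    map_lie' := fun {x y} => by
      obtain ⟨x, rfl⟩ := proj_surjective x
      obtain ⟨y, rfl⟩ := proj_surjective y
      exact LieHom.map_lie (FreeLieAlgebra.lift K (ModelLie.gen : _ → ModelLie K n)) x y }

@[simp]
theorem toModel_gen (i : Fin (n + 2)) : toModel K n (gen K (n + 2) 3 i) = ModelLie.gen i :=
  FreeLieAlgebra.lift_of_apply ..

theorem fstₗ_toModel_eq_zero {x : FreeNilpotentLie K (n + 2) 3}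
    (hx : x ∈ LieModule.lowerCentralSeries K (FreeNilpotentLie K (n + 2) 3)
      (FreeNilpotentLie K (n + 2) 3) 1) : ModelLie.fstₗ (toModel K n x) = 0 :=
  ModelLie.fstₗ_eq_zero_of_mem
    (LieIdeal.map_lowerCentralSeries_le 1 (LieIdeal.mem_map (f := toModel K n) hx))

theorem fstₗ_toModel_sum (c : Fin (n + 2) → K) :
    ModelLie.fstₗ (toModel K n (∑ i, c i • gen K (n + 2) 3 i)) = c := by
  simp only [map_sum, map_smul, toModel_gen, ModelLie.fstₗ_gen]
  exact (pi_eq_sum_univ' c).symm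

theorem linearIndependent_gen : LinearIndependent K (gen K (n + 2) 3) := by
  rw [Fintype.linearIndependent_iff]
  intro c hc
  have := fstₗ_toModel_sum c
  rw [hc, map_zero, map_zero] at this
  exact congr_fun this.symm

theorem finrank_G1 : finrank K (G1 K (n + 2) 3) = n + 2 := by
  rw [G1, finrank_span_eq_card linearIndependent_gen, Fintype.card_fin]

theorem isCompl_G1_lowerCentralSeries_one :
    IsCompl (G1 K (n + 2) 3) (LieModule.lowerCentralSeries K (FreeNilpotentLie K (n + 2) 3)
      (FreeNilpotentLie K (n + 2) 3) 1).toSubmodule := by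
  refine ⟨Submodule.disjoint_def.mpr fun x hx hx' => ?_,
    codisjoint_iff.mpr G1_sup_lowerCentralSeries_one⟩
  obtain ⟨c, rfl⟩ := (Submodule.mem_span_range_iff_exists_fun K).mp hx
  have : c = 0 := (fstₗ_toModel_sum c).symm.trans (fstₗ_toModel_eq_zero hx')
  simp [this]

instance : FiniteDimensional K (G1 K r s) :=
  FiniteDimensional.span_of_finite K (Set.finite_range _)

instance : FiniteDimensional K (FreeNilpotentLie K r 3) :=
  finiteDimensional_of_lowerCentralSeries_three_eq_bot lowerCentralSeries_eq_bot (G1 K r 3)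
    G1_sup_lowerCentralSeries_one

theorem le_finrank_lowerCentralSeries_one :
    n + 2 ≤ finrank K (LieModule.lowerCentralSeries K (FreeNilpotentLie K (n + 2) 3)
      (FreeNilpotentLie K (n + 2) 3) 1).toSubmodule := by
  set C := (LieModule.lowerCentralSeries K (FreeNilpotentLie K (n + 2) 3)
      (FreeNilpotentLie K (n + 2) 3) 1).toSubmodule
  let θ : ModelLie K n →ₗ[K] (Fin (n + 2) → K) :=
    ModelLie.sndₗ + LinearMap.single K (fun _ => K) 0 ∘ₗ ModelLie.thdₗ
  let f := θ ∘ₗ (toModel K n : FreeNilpotentLie K (n + 2) 3 →ₗ[K] ModelLie K n)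
  let X := gen K (n + 2) 3
  have hf : C.map f = ⊤ := by
    rw [eq_top_iff, ← (Pi.basisFun K (Fin (n + 2))).span_eq, Submodule.span_le]
    rintro _ ⟨i, rfl⟩
    rw [Pi.basisFun_apply]
    rcases eq_or_ne i 0 with rfl | hi
    · refine ⟨⁅X 0, ⁅X 0, X 1⁆⁆, lie_mem_lowerCentralSeries_one _ _, ?_⟩
      simp [f, θ, X]
    · refine ⟨⁅X 0, X i⁆, lie_mem_lowerCentralSeries_one _ _, ?_⟩
      simp [f, θ, X, hi.symm]
  have h := Submodule.finrank_map_le f C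
  rwa [hf, finrank_top, Module.finrank_fin_fun] at h

end Model

end FreeNilpotentLie

/-- Let `L` be the free nilpotent Lie algebra of rank `r ≥ 2` and step 3
over a field of characteristic zero and `p ∈ L*`.  Writing `k₁ = dim h₁(p)` and
`k₂ = dim k(p)`, the radical `R(p)` of `B_p` satisfies
`dim R(p) = dim L − 2r + k₁ + k₂` (i.e. the rank of `B_p` is `2r − (k₁ + k₂)`). -/
theorem finrank_radical_eq_dim_sub_two_r_add
    (K : Type*) [Field K] [CharZero K] (r : ℕ) (hr : 2 ≤ r)
    (p : Module.Dual K (FreeNilpotentLie K r 3)) :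
    Module.finrank K (radicalBp p) =
      Module.finrank K (FreeNilpotentLie K r 3) - 2 * r +
      Module.finrank K
        ↥(FreeNilpotentLie.G1 K r 3 ⊓
          perpRight p (LieModule.lowerCentralSeries K (FreeNilpotentLie K r 3)
            (FreeNilpotentLie K r 3) 1 : Set (FreeNilpotentLie K r 3))) +
      Module.finrank K
        ↥((FreeNilpotentLie.G1 K r 3 ⊓
            perpRight p (LieModule.lowerCentralSeries K (FreeNilpotentLie K r 3)
              (FreeNilpotentLie K r 3) 1 : Set (FreeNilpotentLie K r 3))) ⊓
          perpLeft p ((FreeNilpotentLie.G1 K r 3 ⊓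
            perpRight p (LieModule.lowerCentralSeries K (FreeNilpotentLie K r 3)
              (FreeNilpotentLie K r 3) 1 : Set (FreeNilpotentLie K r 3)) :
              Submodule K (FreeNilpotentLie K r 3)) : Set (FreeNilpotentLie K r 3))) := by
  obtain ⟨n, rfl⟩ : ∃ n, r = n + 2 := ⟨r - 2, by lia⟩
  have hcompl := FreeNilpotentLie.isCompl_G1_lowerCentralSeries_one (K := K) (n := n)
  have h₁ := finrank_radicalBp_add_of_isCompl p hcompl fun x hx y hy => by
    have := lie_mem_lowerCentralSeries_three (K := K) hx hy
    rw [FreeNilpotentLie.lowerCentralSeries_eq_bot, LieSubmodule.mem_bot] at this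
    rw [this, map_zero]
  have h₂ := Submodule.finrank_add_eq_of_isCompl hcompl
  have h₃ := FreeNilpotentLie.le_finrank_lowerCentralSeries_one (K := K) (n := n)
  rw [FreeNilpotentLie.finrank_G1] at h₁ h₂
  simp only [LieSubmodule.coe_toSubmodule] at h₁
  omega
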